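/- arXiv:2601.16141 — 9 statements merged into one kernel-verified Lean document; each statement's English description precedes it below -/
import Mathlib

section
/- Let R be a field with algebraic closure R̄, let G be a group, let n ≥ 1, and let ρ : G → GLₙ(R) be a group homomorphism that is absolutely irreducible, meaning that the R̄-linear span of the matrices ρ(g) (g ∈ G), viewed inside the matrix algebra Mₙ(R̄), is all of Mₙ(R̄). For a field automorphism σ of R, let ρ^σ : G → GLₙ(R) be the group homomorphism obtained by applying σ to every matrix entry of ρ(g). Then there exists P ∈ GLₙ(R) with ρ^σ(g) = P · ρ(g) · P⁻¹ for all g ∈ G if and only if σ(tr ρ(g)) = tr ρ(g) for all g ∈ G. (In other words, for absolutely irreducible representations the rationality field coincides with the character field.) -/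
namespace Matrix

variable {ι m K L : Type*} [Field K] [Field L] [Fintype m] [DecidableEq m]

/-- A family of matrices spans the full matrix algebra iff its orthogonal complement for the
trace form is trivial. -/
theorem span_range_eq_top_iff_trace_mul {v : ι → Matrix m m K} :
    Submodule.span K (Set.range v) = ⊤ ↔
      ∀ A : Matrix m m K, (∀ i, (A * v i).trace = 0) → A = 0 := by
  constructor
  · intro h A hA
    have hle : Submodule.span K (Set.range v) ≤
        LinearMap.ker (traceLinearMap m K K ∘ₗ LinearMap.mulLeft K A) := by
      rw [Submodule.span_le]
      rintro _ ⟨i, rfl⟩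
      simpa using hA i
    refine ext_iff_trace_mul_right.2 fun x => ?_
    simpa using hle (h ▸ Submodule.mem_top : x ∈ _)
  · intro h
    by_contra hne
    obtain ⟨f, hf, hle⟩ := Submodule.exists_le_ker_of_lt_top _ (lt_top_iff_ne_top.2 hne)
    let A : Matrix m m K := of fun i j => f (single j i 1)
    have hfA : f = traceLinearMap m K K ∘ₗ LinearMap.mulLeft K A := by
      apply Matrix.ext_linearMap
      intro i j
      ext
      simp [A, trace_mul_single]
    refine hf ?_
    have hA : A = 0 := h A fun i => by
      have := hle (Submodule.subset_span ⟨i, rfl⟩)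
      rw [hfA] at this
      simpa using this
    rw [hfA, hA]
    ext
    simp

/-- Spanning the full matrix algebra descends along field homomorphisms. -/
theorem span_range_eq_top_of_map (f : K →+* L) {v : ι → Matrix m m K}
    (h : Submodule.span L (Set.range fun i => (v i).map f) = ⊤) :
    Submodule.span K (Set.range v) = ⊤ := by
  rw [span_range_eq_top_iff_trace_mul] at h ⊢
  intro A hA
  refine Matrix.map_injective f.injective ?_
  dsimp only
  rw [Matrix.map_zero _ (map_zero f)]
  refine h _ fun i => ?_
  rw [← Matrix.map_mul, ← AddMonoidHom.map_trace f, hA i, map_zero]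

/-- Every algebra automorphism of a matrix algebra over a field is inner. -/
theorem exists_units_conj_of_algEquiv (φ : Matrix m m K ≃ₐ[K] Matrix m m K) :
    ∃ P : (Matrix m m K)ˣ, ∀ A, φ A = P.val * A * (P⁻¹).val := by
  let e : Matrix m m K ≃ₐ[K] Module.End K (m → K) := toLinAlgEquiv'
  obtain ⟨T, hT⟩ := ((e.symm.trans φ).trans e).eq_linearEquivConjAlgEquiv
  refine ⟨Units.map e.symm.toMonoidHom (LinearMap.GeneralLinearGroup.ofLinearEquiv T),
    fun A => e.injective ?_⟩
  have hA := DFunLike.congr_fun hT (e A)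
  rw [AlgEquiv.trans_apply, AlgEquiv.trans_apply, AlgEquiv.symm_apply_apply] at hA
  rw [hA, map_mul, map_mul]
  simp
  rfl

/-- Two matrix representations of a monoid whose images span the full matrix algebra and which
have the same character are conjugate. -/
theorem exists_units_conj_of_trace_eq {G : Type*} [Monoid G] (ρ τ : G →* Matrix m m K)
    (hρ : Submodule.span K (Set.range ρ) = ⊤) (hτ : Submodule.span K (Set.range τ) = ⊤)
    (htr : ∀ g, (ρ g).trace = (τ g).trace) :
    ∃ P : (Matrix m m K)ˣ, ∀ g, τ g = P.val * ρ g * (P⁻¹).val := by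
  have surj : ∀ π : G →* Matrix m m K, Submodule.span K (Set.range π) = ⊤ →
      Function.Surjective (MonoidAlgebra.lift K (Matrix m m K) G π) := by
    intro π hπ
    have hle : Submodule.span K (Set.range π) ≤
        LinearMap.range (MonoidAlgebra.lift K (Matrix m m K) G π).toLinearMap := by
      rw [Submodule.span_le]
      rintro _ ⟨g, rfl⟩
      exact ⟨MonoidAlgebra.of K G g, by simp⟩
    exact fun x => hle (hπ ▸ Submodule.mem_top)
  have mem_ker : ∀ π : G →* Matrix m m K, Submodule.span K (Set.range π) = ⊤ → ∀ x,
      x ∈ RingHom.ker (MonoidAlgebra.lift K (Matrix m m K) G π) ↔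
        ∀ g, (MonoidAlgebra.lift K (Matrix m m K) G π
          (x * MonoidAlgebra.of K G g)).trace = 0 := by
    intro π hπ x
    simp only [map_mul, MonoidAlgebra.lift_of]
    exact ⟨fun h g => by rw [RingHom.mem_ker.1 h]; simp,
      span_range_eq_top_iff_trace_mul.1 hπ _⟩
  have trace_eq : ∀ x, (MonoidAlgebra.lift K (Matrix m m K) G ρ x).trace =
      (MonoidAlgebra.lift K (Matrix m m K) G τ x).trace := by
    intro x
    simp [MonoidAlgebra.lift_apply, Finsupp.sum, trace_sum, trace_smul, htr]
  have hker : RingHom.ker (MonoidAlgebra.lift K (Matrix m m K) G ρ) =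
      RingHom.ker (MonoidAlgebra.lift K (Matrix m m K) G τ) := by
    ext x
    simp only [mem_ker ρ hρ, mem_ker τ hτ, trace_eq]
  obtain ⟨P, hP⟩ := exists_units_conj_of_algEquiv
    (((Ideal.quotientKerAlgEquivOfSurjective (surj ρ hρ)).symm.trans
      (Ideal.quotientEquivAlgOfEq K hker)).trans
        (Ideal.quotientKerAlgEquivOfSurjective (surj τ hτ)))
  refine ⟨P, fun g => ?_⟩
  have h := hP (MonoidAlgebra.lift K (Matrix m m K) G ρ (MonoidAlgebra.of K G g))
  rw [AlgEquiv.trans_apply, AlgEquiv.trans_apply,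
    Ideal.quotientKerAlgEquivOfSurjective_symm_apply, Ideal.quotientEquivAlgOfEq_mk,
    Ideal.quotientKerAlgEquivOfSurjective_mk] at h
  simpa using h

end Matrix

/-- For an absolutely irreducible representation `ρ : G → GLₙ(R)` (meaning that the
`R̄`-linear span of the image matrices, viewed in `Mₙ(R̄)`, is everything), and a field
automorphism `σ` of `R`, the entrywise twist `ρ^σ` is conjugate to `ρ` by some
`P ∈ GLₙ(R)` if and only if `σ` fixes all the traces `tr ρ(g)`: for absolutely
irreducible representations the rationality field coincides with the character field. -/
theorem twist_isConj_iff_trace_fixed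
    (R : Type*) [Field R] (G : Type*) [Group G] (n : ℕ) (hn : 1 ≤ n)
    (ρ : G →* (Matrix (Fin n) (Fin n) R)ˣ)
    (habs : Submodule.span (AlgebraicClosure R)
      (Set.range fun g : G => ((ρ g).val).map (algebraMap R (AlgebraicClosure R))) = ⊤)
    (σ : R ≃+* R) :
    (∃ P : (Matrix (Fin n) (Fin n) R)ˣ,
        ∀ g : G, ((ρ g).val).map σ = P.val * (ρ g).val * (P⁻¹).val) ↔
      ∀ g : G, σ (Matrix.trace (ρ g).val) = Matrix.trace (ρ g).val := by
  have trace_map : ∀ A : Matrix (Fin n) (Fin n) R, (A.map σ).trace = σ A.trace :=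
    fun A => (AddMonoidHom.map_trace σ A).symm
  constructor
  · rintro ⟨P, hP⟩ g
    rw [← trace_map, hP g, Matrix.trace_mul_cycle, Units.inv_mul, one_mul]
  · intro h
    let ρ₁ : G →* Matrix (Fin n) (Fin n) R := (Units.coeHom _).comp ρ
    let τ : G →* Matrix (Fin n) (Fin n) R := (σ : R →+* R).mapMatrix.toMonoidHom.comp ρ₁
    have hρ : Submodule.span R (Set.range ρ₁) = ⊤ := Matrix.span_range_eq_top_of_map _ habs
    have hτ : Submodule.span R (Set.range τ) = ⊤ := by
      refine Matrix.span_range_eq_top_of_map (σ.symm : R →+* R) ?_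
      convert hρ using 3
      ext g i j
      simp [τ]
    exact Matrix.exists_units_conj_of_trace_eq ρ₁ τ hρ hτ fun g =>
      ((trace_map _).trans (h g)).symm
end

section
/- Let R be a perfect field and let D₁ and D₂ be division algebras over R that are finite-dimensional as R-vector spaces. Then the tensor product algebra D₁ ⊗_R D₂ is a semisimple ring. -/
open scoped TensorProduct

/-- Over a perfect field, the tensor product of two finite-dimensional commutative domains is
reduced. -/
theorem PerfectField.isReduced_tensorProduct (K A B : Type*) [Field K] [PerfectField K]
    [CommRing A] [IsDomain A] [Algebra K A] [FiniteDimensional K A]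
    [CommRing B] [IsDomain B] [Algebra K B] [FiniteDimensional K B] :
    IsReduced (A ⊗[K] B) := by
  let : Field A := (isField_of_isIntegral_of_isField' (Field.toIsField K)).toField
  let : Field B := (isField_of_isIntegral_of_isField' (Field.toIsField K)).toField
  have : Algebra.FormallyUnramified K B := .of_isSeparable K B
  exact Algebra.FormallyUnramified.isReduced_of_field A (A ⊗[K] B)

/-- Over a field `K`, every central element of `A ⊗[K] B` comes from the tensor product of the
centers. -/
theorem Subalgebra.center_tensorProduct_le (K A B : Type*) [Field K] [Ring A] [Algebra K A]
    [Ring B] [Algebra K B] :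
    Subalgebra.center K (A ⊗[K] B) ≤
      (Algebra.TensorProduct.map (Subalgebra.center K A).val
        (Subalgebra.center K B).val).range := by
  intro x hx
  rw [Subalgebra.mem_center_iff] at hx
  have hleft : x ∈ Subalgebra.centralizer K
      (Algebra.TensorProduct.includeLeft : A →ₐ[K] A ⊗[K] B).range :=
    Subalgebra.mem_centralizer_iff K |>.mpr fun y _ ↦ hx y
  rw [Subalgebra.centralizer_coe_range_includeLeft_eq_center_tensorProduct] at hleft
  obtain ⟨y, rfl⟩ := hleft
  have hinj : Function.Injective
      (Algebra.TensorProduct.map (Subalgebra.center K A).val (AlgHom.id K B)) :=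
    TensorProduct.map_injective_of_flat_flat (Subalgebra.center K A).val.toLinearMap
      LinearMap.id Subtype.val_injective Function.injective_id
  have hright : y ∈ Subalgebra.centralizer K
      (Algebra.TensorProduct.includeRight : B →ₐ[K] Subalgebra.center K A ⊗[K] B).range :=
    Subalgebra.mem_centralizer_iff K |>.mpr fun z _ ↦ hinj <| by
      rw [map_mul, map_mul]
      exact hx _
  rw [Subalgebra.centralizer_range_includeRight_eq_center_tensorProduct] at hright
  obtain ⟨z, rfl⟩ := hright
  refine ⟨z, ?_⟩
  change _ = ((Algebra.TensorProduct.map _ _).comp (Algebra.TensorProduct.map _ _)) z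
  rw [← Algebra.TensorProduct.map_comp]
  rfl

/-- The center of the tensor product of two finite-dimensional division algebras over a perfect
field contains no nonzero nilpotent element. -/
theorem PerfectField.eq_zero_of_isNilpotent_of_mem_center_tensorProduct {K D E : Type*} [Field K]
    [PerfectField K] [DivisionRing D] [Algebra K D] [FiniteDimensional K D]
    [DivisionRing E] [Algebra K E] [FiniteDimensional K E] {x : D ⊗[K] E}
    (hx : x ∈ Subalgebra.center K (D ⊗[K] E)) (hnil : IsNilpotent x) : x = 0 := by
  obtain ⟨z, rfl⟩ := Subalgebra.center_tensorProduct_le K D E hx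
  have hinj : Function.Injective
      (Algebra.TensorProduct.map (Subalgebra.center K D).val (Subalgebra.center K E).val) :=
    TensorProduct.map_injective_of_flat_flat (Subalgebra.center K D).val.toLinearMap
      (Subalgebra.center K E).val.toLinearMap Subtype.val_injective Subtype.val_injective
  have := PerfectField.isReduced_tensorProduct K (Subalgebra.center K D) (Subalgebra.center K E)
  have hz : IsNilpotent z := (IsNilpotent.map_iff hinj).mp hnil
  simp [hz.eq_zero]

/-- A nonzero additive subgroup of `D ⊗[K] B`, with `D` a division algebra, that is stable under
multiplication by `D` on both sides contains a nonzero element commuting with `D`. -/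
theorem AddSubgroup.exists_ne_zero_commute_tmul_one {K D B : Type*} [Field K] [DivisionRing D]
    [Algebra K D] [Ring B] [Algebra K B] (M : AddSubgroup (D ⊗[K] B)) (hM : M ≠ ⊥)
    (hleft : ∀ (d : D), ∀ x ∈ M, (d ⊗ₜ[K] (1 : B)) * x ∈ M)
    (hright : ∀ (d : D), ∀ x ∈ M, x * (d ⊗ₜ[K] (1 : B)) ∈ M) :
    ∃ x ∈ M, x ≠ 0 ∧ ∀ d : D, Commute (d ⊗ₜ[K] (1 : B)) x := by
  let b := Module.Basis.ofVectorSpace K B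
  let c := Algebra.TensorProduct.basis D b
  have repr_left (d : D) (x : D ⊗[K] B) (i) :
      c.repr (d ⊗ₜ[K] (1 : B) * x) i = d * c.repr x i := by
    induction x with
    | zero => simp
    | add x y hx hy => simp [mul_add, hx, hy]
    | tmul a m => simp [c, mul_assoc]
  have repr_right (d : D) (x : D ⊗[K] B) (i) :
      c.repr (x * d ⊗ₜ[K] (1 : B)) i = c.repr x i * d := by
    induction x with
    | zero => simp
    | add x y hx hy => simp [add_mul, hx, hy]
    | tmul a m => simp [c, mul_assoc, Algebra.commutes]
  obtain ⟨y, hyM, hy0⟩ := M.bot_or_exists_ne_zero.resolve_left hM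
  obtain ⟨x, ⟨hxM, hx0⟩, hmin⟩ := WellFounded.has_min
    (measure fun x : D ⊗[K] B ↦ (c.repr x).support.card).wf {x | x ∈ M ∧ x ≠ 0} ⟨y, hyM, hy0⟩
  obtain ⟨i, hi⟩ : ∃ i, c.repr x i ≠ 0 := by
    by_contra! h
    exact hx0 (c.repr.map_eq_zero_iff.mp (Finsupp.ext h))
  set a := c.repr x i
  let u := a⁻¹ ⊗ₜ[K] (1 : B) * x
  have hui : c.repr u i = 1 := by rw [repr_left]; exact inv_mul_cancel₀ hi
  have huM : u ∈ M := hleft _ _ hxM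
  refine ⟨u, huM, fun h ↦ by simp [h] at hui, fun d ↦ ?_⟩
  by_contra hd
  refine hmin (d ⊗ₜ[K] (1 : B) * u - u * d ⊗ₜ[K] (1 : B))
    ⟨M.sub_mem (hleft d u huM) (hright d u huM), sub_ne_zero.mpr hd⟩ ?_
  refine Finset.card_lt_card (Finset.ssubset_iff_of_subset ?_ |>.mpr ⟨i, ?_, ?_⟩)
  · intro j
    simp only [Finsupp.mem_support_iff, map_sub, Finsupp.sub_apply, repr_left, repr_right, u]
    contrapose!
    intro h
    simp [h]
  · simpa using hi
  · simp [repr_left, repr_right, hui]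

/-- A nonzero two-sided ideal of the tensor product of two division algebras contains a nonzero
central element. -/
theorem Ideal.exists_ne_zero_mem_center_tensorProduct {K D E : Type*} [Field K] [DivisionRing D]
    [Algebra K D] [DivisionRing E] [Algebra K E] (I : Ideal (D ⊗[K] E)) [I.IsTwoSided]
    (hI : I ≠ ⊥) : ∃ x ∈ I, x ≠ 0 ∧ x ∈ Subalgebra.center K (D ⊗[K] E) := by
  obtain ⟨x, hxI, hx0, hx⟩ := AddSubgroup.exists_ne_zero_commute_tmul_one I.toAddSubgroup
    (fun h ↦ hI (Submodule.toAddSubgroup_injective h))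
    (fun d x hx ↦ I.mul_mem_left _ hx) (fun d x hx ↦ I.mul_mem_right _ hx)
  let e := Algebra.TensorProduct.comm K E D
  have he (s : E) : e (s ⊗ₜ 1) = 1 ⊗ₜ s := rfl
  have hcomm (d : D) (s : E) : Commute (d ⊗ₜ[K] (1 : E)) ((1 : D) ⊗ₜ[K] s) := by
    simp [commute_iff_eq]
  let N : AddSubgroup (D ⊗[K] E) :=
    { carrier := {y | y ∈ I ∧ ∀ d : D, Commute (d ⊗ₜ[K] (1 : E)) y}
      add_mem' := fun hy hz ↦ ⟨I.add_mem hy.1 hz.1, fun d ↦ (hy.2 d).add_right (hz.2 d)⟩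
      zero_mem' := ⟨I.zero_mem, fun d ↦ .zero_right _⟩
      neg_mem' := fun hy ↦ ⟨I.neg_mem hy.1, fun d ↦ (hy.2 d).neg_right⟩ }
  obtain ⟨y, ⟨hyI, hyD⟩, hy0, hyE⟩ := AddSubgroup.exists_ne_zero_commute_tmul_one
    (N.comap (e : E ⊗[K] D →+ D ⊗[K] E))
    (fun h ↦ hx0 <| by
      have hmem : e.symm x ∈ N.comap (e : E ⊗[K] D →+ D ⊗[K] E) := by
        change e (e.symm x) ∈ N
        rw [e.apply_symm_apply]
        exact ⟨hxI, hx⟩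
      rw [h, AddSubgroup.mem_bot] at hmem
      simpa using hmem)
    (fun s y hy ↦ by
      change e _ ∈ N
      rw [map_mul, he]
      exact ⟨I.mul_mem_left _ hy.1, fun d ↦ (hcomm d s).mul_right (hy.2 d)⟩)
    (fun s y hy ↦ by
      change e _ ∈ N
      rw [map_mul, he]
      exact ⟨I.mul_mem_right _ hy.1, fun d ↦ (hy.2 d).mul_right (hcomm d s)⟩)
  refine ⟨e y, hyI, by simpa using hy0, Subalgebra.mem_center_iff.mpr fun z ↦ ?_⟩
  change Commute z (e y)
  induction z with
  | zero => exact .zero_left _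
  | add z w hz hw => exact hz.add_left hw
  | tmul d s =>
    have hs : Commute ((1 : D) ⊗ₜ[K] s) (e y) := (hyE s).map e
    simpa using (hyD d).mul_left hs

/-- Let `R` be a perfect field and `D₁`, `D₂` division algebras over `R` that are
finite-dimensional as `R`-vector spaces. Then `D₁ ⊗[R] D₂` is a semisimple ring. -/
theorem tensor_product_of_division_algebras_isSemisimpleRing
    (R : Type*) [Field R] [PerfectField R]
    (D₁ D₂ : Type*) [DivisionRing D₁] [DivisionRing D₂]
    [Algebra R D₁] [Algebra R D₂]
    [FiniteDimensional R D₁] [FiniteDimensional R D₂] :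
    IsSemisimpleRing (D₁ ⊗[R] D₂) := by
  have : IsArtinianRing (D₁ ⊗[R] D₂) := .of_finite R _
  rw [IsArtinianRing.isSemisimpleRing_iff_jacobson]
  by_contra hJ
  obtain ⟨x, hxJ, hx0, hx⟩ := Ideal.exists_ne_zero_mem_center_tensorProduct (K := R) _ hJ
  obtain ⟨n, hn⟩ := IsSemiprimaryRing.isNilpotent (R := D₁ ⊗[R] D₂)
  have hpow := Ideal.pow_mem_pow hxJ n
  rw [hn] at hpow
  exact hx0 (PerfectField.eq_zero_of_isNilpotent_of_mem_center_tensorProduct hx ⟨n, hpow⟩)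
end

section
/- Let R be a perfect field, let A₁ and A₂ be (possibly noncommutative) R-algebras, let V₁ be a simple A₁-module and V₂ a simple A₂-module, and assume that the endomorphism rings End_{A₁}(V₁) and End_{A₂}(V₂) are finite-dimensional as R-vector spaces. Then V₁ ⊗_R V₂, equipped with its natural structure of module over the R-algebra A₁ ⊗_R A₂ (given by (a₁ ⊗ a₂) · (v₁ ⊗ v₂) = (a₁·v₁) ⊗ (a₂·v₂)), is a semisimple A₁ ⊗_R A₂-module. -/
open scoped TensorProduct

/-- A nonzero two-sided ideal of `D ⊗[R] B`, with `D` a division algebra, contains a nonzero element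
coming from the tensor product of the center of `D` with `B`. -/
theorem Ideal.exists_map_center_mem_of_ne_bot {R D B : Type*} [Field R] [DivisionRing D] [Ring B]
    [Algebra R D] [Algebra R B] (J : Ideal (D ⊗[R] B)) [J.IsTwoSided] (hJ : J ≠ ⊥) :
    ∃ z : Subalgebra.center R D ⊗[R] B,
      Algebra.TensorProduct.map (Subalgebra.center R D).val (AlgHom.id R B) z ∈ J ∧
      Algebra.TensorProduct.map (Subalgebra.center R D).val (AlgHom.id R B) z ≠ 0 := by
  classical
  let b := Module.Basis.ofVectorSpace R B
  let β := Algebra.TensorProduct.basis D b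
  have repr_mul (d : D) (x : D ⊗[R] B) (i) :
      β.repr (d ⊗ₜ 1 * x) i = d * β.repr x i := by
    induction x with
    | zero => simp
    | tmul x y => simp [β, mul_assoc]
    | add x y hx hy => simp [mul_add, hx, hy]
  have repr_mul' (d : D) (x : D ⊗[R] B) (i) :
      β.repr (x * d ⊗ₜ 1) i = β.repr x i * d := by
    induction x with
    | zero => simp
    | tmul x y => simp [β, mul_assoc, Algebra.commutes]
    | add x y hx hy => simp [add_mul, hx, hy]
  obtain ⟨x₀, hx₀, hx₀'⟩ := Submodule.exists_mem_ne_zero_of_ne_bot hJ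
  obtain ⟨x, ⟨hxJ, hx⟩, hmin⟩ := exists_minimalFor_of_wellFoundedLT
    (fun x : D ⊗[R] B ↦ x ∈ J ∧ x ≠ 0) (fun x ↦ (β.repr x).support.card) ⟨x₀, hx₀, hx₀'⟩
  obtain ⟨i, hi⟩ : ∃ i, β.repr x i ≠ 0 := by
    by_contra! h
    exact hx (β.repr.map_eq_zero_iff.mp (Finsupp.ext h))
  let y := ((β.repr x i)⁻¹ ⊗ₜ[R] (1 : B)) * x
  have hyJ : y ∈ J := J.mul_mem_left _ hxJ
  have hy (j) : β.repr y j = (β.repr x i)⁻¹ * β.repr x j := repr_mul ..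
  have hyi : β.repr y i = 1 := by rw [hy, inv_mul_cancel₀ hi]
  have hy0 : y ≠ 0 := by
    rintro h
    simp [h] at hyi
  have hcomm (d : D) : (d ⊗ₜ[R] (1 : B)) * y - y * (d ⊗ₜ[R] (1 : B)) = 0 := by
    by_contra h
    have hlt : (β.repr ((d ⊗ₜ[R] (1 : B)) * y - y * (d ⊗ₜ[R] (1 : B)))).support.card <
        (β.repr x).support.card := by
      refine Finset.card_lt_card (Finset.ssubset_iff_of_subset (fun j hj ↦ ?_) |>.mpr
        ⟨i, Finsupp.mem_support_iff.mpr hi, ?_⟩)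
      · rw [Finsupp.mem_support_iff, map_sub, Finsupp.sub_apply, repr_mul, repr_mul', hy] at hj
        rw [Finsupp.mem_support_iff]
        rintro h0
        simp [h0] at hj
      · rw [Finsupp.notMem_support_iff, map_sub, Finsupp.sub_apply, repr_mul, repr_mul', hyi]
        simp
    exact hlt.not_ge (hmin ⟨J.sub_mem (J.mul_mem_left _ hyJ) (J.mul_mem_right _ hyJ), h⟩ hlt.le)
  have hcenter (j) : β.repr y j ∈ Subalgebra.center R D := by
    rw [Subalgebra.mem_center_iff]
    intro d
    have := congr(β.repr $(hcomm d) j)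
    rw [map_sub, Finsupp.sub_apply, repr_mul, repr_mul'] at this
    simpa [sub_eq_zero] using this
  have hmap : Algebra.TensorProduct.map (Subalgebra.center R D).val (AlgHom.id R B)
      (∑ j ∈ (β.repr y).support, (⟨β.repr y j, hcenter j⟩ : Subalgebra.center R D) ⊗ₜ b j) = y := by
    conv_rhs => rw [← β.linearCombination_repr y, Finsupp.linearCombination_apply, Finsupp.sum]
    simp [β, TensorProduct.smul_tmul']
  exact ⟨_, hmap.symm ▸ hyJ, hmap.symm ▸ hy0⟩

/-- The tensor product of two field extensions of a perfect field, one of them finite, is reduced. -/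
theorem IsField.isReduced_tensorProduct_of_perfectField {R K L : Type*} [Field R] [PerfectField R]
    [CommRing K] [CommRing L] [Algebra R K] [Algebra R L] [FiniteDimensional R L]
    (hK : IsField K) (hL : IsField L) : IsReduced (K ⊗[R] L) := by
  let _ := hK.toField
  let _ := hL.toField
  have : Algebra.FormallyUnramified R L := Algebra.FormallyUnramified.of_isSeparable R L
  exact Algebra.FormallyUnramified.isReduced_of_field K (K ⊗[R] L)

/-- Over a perfect field, the tensor product of two finite-dimensional division algebras is a
semisimple ring. -/
theorem isSemisimpleRing_tensorProduct_of_divisionRing (R D E : Type*) [Field R] [PerfectField R]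
    [DivisionRing D] [DivisionRing E] [Algebra R D] [Algebra R E] [FiniteDimensional R D]
    [FiniteDimensional R E] : IsSemisimpleRing (D ⊗[R] E) := by
  have : IsArtinianRing (D ⊗[R] E) := .of_finite R _
  rw [IsArtinianRing.isSemisimpleRing_iff_jacobson]
  by_contra hJ
  obtain ⟨z, hzJ, hz0⟩ := Ideal.exists_map_center_mem_of_ne_bot _ hJ
  let f : E ⊗[R] Subalgebra.center R D →ₐ[R] D ⊗[R] E :=
    (Algebra.TensorProduct.map (Subalgebra.center R D).val (AlgHom.id R E)).comp
      (Algebra.TensorProduct.comm R E _).toAlgHom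
  have hf : Function.Injective f :=
    (TensorProduct.map_injective_of_flat_flat (Subalgebra.center R D).val.toLinearMap
      (LinearMap.id : E →ₗ[R] E) Subtype.val_injective Function.injective_id).comp
      (Algebra.TensorProduct.comm R E _).injective
  obtain ⟨w, hwJ, hw0⟩ := Ideal.exists_map_center_mem_of_ne_bot
    ((Ring.jacobson (D ⊗[R] E)).comap f) (by
      refine Submodule.ne_bot_iff _ |>.mpr ⟨(Algebra.TensorProduct.comm R E _).symm z, ?_, ?_⟩
      · simpa [f, Ideal.mem_comap] using hzJ
      · rintro h
        simp at h
        simp [h] at hz0)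
  have : IsReduced (Subalgebra.center R E ⊗[R] Subalgebra.center R D) :=
    IsField.isReduced_tensorProduct_of_perfectField
      (IsSimpleRing.isField_center E) (IsSimpleRing.isField_center D)
  let g := Algebra.TensorProduct.map (Subalgebra.center R E).val
    (AlgHom.id R (Subalgebra.center R D))
  have hg : Function.Injective g :=
    TensorProduct.map_injective_of_flat_flat (Subalgebra.center R E).val.toLinearMap
      (LinearMap.id : Subalgebra.center R D →ₗ[R] _) Subtype.val_injective Function.injective_id
  obtain ⟨n, hn⟩ := IsArtinianRing.isNilpotent_jacobson_bot (R := D ⊗[R] E)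
  have hnil : IsNilpotent w := by
    refine ⟨n, (hf.comp hg) ?_⟩
    have : f (g w) ^ n ∈ (Ring.jacobson (D ⊗[R] E)) ^ n :=
      Ideal.pow_mem_pow (Ideal.mem_comap.mp hwJ) n
    rw [← Ideal.jacobson_bot, hn] at this
    simpa using this
  exact hw0 (by rw [hnil.eq_zero, map_zero])

/-- Density: a scalar can send one member of a basis over the endomorphism ring to any given vector
and annihilate finitely many others. -/
theorem IsSimpleModule.exists_smul_basis_eq {A V ι : Type*} [Ring A] [AddCommGroup V] [Module A V]
    [IsSimpleModule A V] [DecidableEq ι] (b : Module.Basis ι (Module.End A V) V) (s : Finset ι)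
    (i : ι) (v : V) : ∃ a : A, a • b i = v ∧ ∀ j ∈ s, j ≠ i → a • b j = 0 := by
  classical
  obtain ⟨a, ha⟩ := jacobson_density (R := A) (b.constr ℕ (Pi.single i v))
    ((insert i s).image b)
  refine ⟨a, ?_, fun j hj hji ↦ ?_⟩
  · rw [← ha _ (Finset.mem_image_of_mem _ (Finset.mem_insert_self i s)), b.constr_basis,
      Pi.single_eq_same]
  · rw [← ha _ (Finset.mem_image_of_mem _ (Finset.mem_insert_of_mem hj)), b.constr_basis,
      Pi.single_eq_of_ne hji]

/-- A pure tensor of nonzero elements of simple modules generates the tensor product. -/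
theorem exists_smul_tmul_eq {R A₁ A₂ V₁ V₂ : Type*} [Field R] [Ring A₁] [Ring A₂] [Algebra R A₁]
    [Algebra R A₂] [AddCommGroup V₁] [AddCommGroup V₂] [Module R V₁] [Module R V₂] [Module A₁ V₁]
    [Module A₂ V₂] [Module (A₁ ⊗[R] A₂) (V₁ ⊗[R] V₂)]
    [IsSimpleModule A₁ V₁] [IsSimpleModule A₂ V₂]
    (hsmul : ∀ (a₁ : A₁) (a₂ : A₂) (v₁ : V₁) (v₂ : V₂),
      (a₁ ⊗ₜ[R] a₂) • (v₁ ⊗ₜ[R] v₂) = (a₁ • v₁) ⊗ₜ[R] (a₂ • v₂))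
    {v₁ : V₁} {v₂ : V₂} (h₁ : v₁ ≠ 0) (h₂ : v₂ ≠ 0) (w : V₁ ⊗[R] V₂) :
    ∃ a : A₁ ⊗[R] A₂, a • (v₁ ⊗ₜ[R] v₂) = w := by
  induction w with
  | zero => exact ⟨0, zero_smul ..⟩
  | add x y hx hy =>
    obtain ⟨a, rfl⟩ := hx
    obtain ⟨a', rfl⟩ := hy
    exact ⟨a + a', add_smul ..⟩
  | tmul x y =>
    obtain ⟨a₁, rfl⟩ := IsSimpleModule.toSpanSingleton_surjective A₁ h₁ x
    obtain ⟨a₂, rfl⟩ := IsSimpleModule.toSpanSingleton_surjective A₂ h₂ y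
    exact ⟨a₁ ⊗ₜ a₂, hsmul ..⟩

section

variable {R A₁ A₂ V₁ V₂ : Type*} [Field R] [Ring A₁] [Ring A₂] [Algebra R A₁] [Algebra R A₂]
  [AddCommGroup V₁] [AddCommGroup V₂] [Module R V₁] [Module R V₂] [Module A₁ V₁] [Module A₂ V₂]
  [IsScalarTower R A₁ V₁] [IsScalarTower R A₂ V₂] [SMulCommClass A₁ R V₁] [SMulCommClass A₂ R V₂]

variable (R A₁ A₂ V₁ V₂) in
/-- The action of `End A₁ V₁ ⊗[R] End A₂ V₂` on `V₁ ⊗[R] V₂`. -/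
noncomputable def endTensorEndToEnd :
    Module.End A₁ V₁ ⊗[R] Module.End A₂ V₂ →ₐ[R] Module.End R (V₁ ⊗[R] V₂) :=
  (Module.endTensorEndAlgHom (A := R)).comp
    (Algebra.TensorProduct.map (Algebra.lsmul R R V₁) (Algebra.lsmul R R V₂))

@[simp]
theorem endTensorEndToEnd_tmul_tmul (d₁ : Module.End A₁ V₁) (d₂ : Module.End A₂ V₂) (v₁ : V₁)
    (v₂ : V₂) : endTensorEndToEnd R A₁ A₂ V₁ V₂ (d₁ ⊗ₜ d₂) (v₁ ⊗ₜ v₂) = d₁ v₁ ⊗ₜ d₂ v₂ :=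
  rfl

/-- Bases of `V₁` and `V₂` over their endomorphism rings generate `V₁ ⊗[R] V₂` over the tensor
product of these rings. -/
theorem exists_finsupp_sum_endTensorEndToEnd_eq {ι κ : Type*}
    (b : Module.Basis ι (Module.End A₁ V₁) V₁) (c : Module.Basis κ (Module.End A₂ V₂) V₂)
    (w : V₁ ⊗[R] V₂) : ∃ d : ι × κ →₀ Module.End A₁ V₁ ⊗[R] Module.End A₂ V₂,
      (d.sum fun i x ↦ endTensorEndToEnd R A₁ A₂ V₁ V₂ x (b i.1 ⊗ₜ c i.2)) = w := by
  let _ : Module (Module.End A₁ V₁ ⊗[R] Module.End A₂ V₂) (V₁ ⊗[R] V₂) :=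
    Module.compHom _ (endTensorEndToEnd R A₁ A₂ V₁ V₂).toRingHom
  have smul_tmul (d₁ : Module.End A₁ V₁) (d₂ : Module.End A₂ V₂) (v₁ : V₁) (v₂ : V₂) :
      (d₁ ⊗ₜ[R] d₂) • (v₁ ⊗ₜ[R] v₂) = d₁ v₁ ⊗ₜ d₂ v₂ := rfl
  suffices w ∈ Submodule.span (Module.End A₁ V₁ ⊗[R] Module.End A₂ V₂)
      (Set.range fun i : ι × κ ↦ b i.1 ⊗ₜ[R] c i.2) from
    Finsupp.mem_span_range_iff_exists_finsupp.mp this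
  induction w with
  | zero => exact zero_mem _
  | add x y hx hy => exact add_mem hx hy
  | tmul v₁ v₂ =>
    induction b.mem_span v₁ using Submodule.span_induction with
    | zero => simp
    | add x y _ _ hx hy => simpa [TensorProduct.add_tmul] using add_mem hx hy
    | smul d x _ hx =>
      simpa [smul_tmul] using Submodule.smul_mem _ (d ⊗ₜ[R] (1 : Module.End A₂ V₂)) hx
    | mem x hx =>
      obtain ⟨i, rfl⟩ := hx
      induction c.mem_span v₂ using Submodule.span_induction with
      | zero => simp
      | add x y _ _ hx hy => simpa [TensorProduct.tmul_add] using add_mem hx hy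
      | smul d x _ hx =>
        simpa [smul_tmul] using Submodule.smul_mem _ ((1 : Module.End A₁ V₁) ⊗ₜ[R] d) hx
      | mem x hx =>
        obtain ⟨j, rfl⟩ := hx
        exact Submodule.subset_span ⟨(i, j), rfl⟩

variable [Module (A₁ ⊗[R] A₂) (V₁ ⊗[R] V₂)]

/-- The action of `End A₁ V₁ ⊗[R] End A₂ V₂` commutes with that of `A₁ ⊗[R] A₂`. -/
theorem endTensorEndToEnd_smul (hsmul : ∀ (a₁ : A₁) (a₂ : A₂) (v₁ : V₁) (v₂ : V₂),
      (a₁ ⊗ₜ[R] a₂) • (v₁ ⊗ₜ[R] v₂) = (a₁ • v₁) ⊗ₜ[R] (a₂ • v₂))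
    (d : Module.End A₁ V₁ ⊗[R] Module.End A₂ V₂) (a : A₁ ⊗[R] A₂) (v : V₁ ⊗[R] V₂) :
    endTensorEndToEnd R A₁ A₂ V₁ V₂ d (a • v) = a • endTensorEndToEnd R A₁ A₂ V₁ V₂ d v := by
  induction a with
  | zero => simp
  | add a a' ha ha' => simp [add_smul, ha, ha']
  | tmul a₁ a₂ =>
    induction v with
    | zero => simp
    | add v v' hv hv' => simp [smul_add, hv, hv']
    | tmul v₁ v₂ =>
      induction d with
      | zero => simp
      | add d d' hd hd' => simp [smul_add, hd, hd']
      | tmul d₁ d₂ => simp [hsmul]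

end

/-- Let `R` be a perfect field, `A₁`, `A₂` be `R`-algebras, `V₁` a simple `A₁`-module and
`V₂` a simple `A₂`-module whose endomorphism rings are finite-dimensional over `R`.
Then `V₁ ⊗[R] V₂`, with its natural `A₁ ⊗[R] A₂`-module structure (characterised by
`(a₁ ⊗ a₂) • (v₁ ⊗ v₂) = (a₁ • v₁) ⊗ (a₂ • v₂)`), is a semisimple module. -/
theorem tensor_product_of_simple_modules_isSemisimple
    (R : Type*) [Field R] [PerfectField R]
    (A₁ A₂ : Type*) [Ring A₁] [Ring A₂] [Algebra R A₁] [Algebra R A₂]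
    (V₁ V₂ : Type*) [AddCommGroup V₁] [AddCommGroup V₂]
    [Module R V₁] [Module R V₂]
    [Module A₁ V₁] [Module A₂ V₂]
    [IsScalarTower R A₁ V₁] [IsScalarTower R A₂ V₂]
    [SMulCommClass A₁ R V₁] [SMulCommClass A₂ R V₂]
    [IsSimpleModule A₁ V₁] [IsSimpleModule A₂ V₂]
    [FiniteDimensional R (Module.End A₁ V₁)] [FiniteDimensional R (Module.End A₂ V₂)]
    [Module (A₁ ⊗[R] A₂) (V₁ ⊗[R] V₂)]
    (hsmul : ∀ (a₁ : A₁) (a₂ : A₂) (v₁ : V₁) (v₂ : V₂),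
      (a₁ ⊗ₜ[R] a₂) • (v₁ ⊗ₜ[R] v₂) = (a₁ • v₁) ⊗ₜ[R] (a₂ • v₂)) :
    IsSemisimpleModule (A₁ ⊗[R] A₂) (V₁ ⊗[R] V₂) := by
  classical
  let φ := endTensorEndToEnd R A₁ A₂ V₁ V₂
  have hφ := endTensorEndToEnd_smul hsmul
  have : IsSemisimpleRing (Module.End A₁ V₁ ⊗[R] Module.End A₂ V₂) :=
    isSemisimpleRing_tensorProduct_of_divisionRing R _ _
  have := IsSimpleModule.nontrivial A₁ V₁
  have := IsSimpleModule.nontrivial A₂ V₂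
  obtain ⟨v₁, h₁⟩ := exists_ne (0 : V₁)
  obtain ⟨v₂, h₂⟩ := exists_ne (0 : V₂)
  let b := Module.Basis.ofVectorSpace (Module.End A₁ V₁) V₁
  let c := Module.Basis.ofVectorSpace (Module.End A₂ V₂) V₂
  refine { exists_isCompl := fun W ↦ ?_ }
  -- the right ideal of those `d` with `d • (v₁ ⊗ v₂) ∈ W`
  let I : Ideal (Module.End A₁ V₁ ⊗[R] Module.End A₂ V₂)ᵐᵒᵖ :=
    { carrier := {d | φ d.unop (v₁ ⊗ₜ v₂) ∈ W}
      zero_mem' := by simp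
      add_mem' := fun hx hy ↦ by simpa using add_mem hx hy
      smul_mem' := fun y x hx ↦ by
        obtain ⟨a, ha⟩ := exists_smul_tmul_eq hsmul h₁ h₂ (φ y.unop (v₁ ⊗ₜ v₂))
        simpa [← ha, φ, hφ] using W.smul_mem a hx }
  obtain ⟨p, hp, hI⟩ := IsSemisimpleRing.ideal_eq_span_idempotent I
  have hpI : φ p.unop (v₁ ⊗ₜ v₂) ∈ W := (hI ▸ Ideal.mem_span_singleton_self p : p ∈ I)
  have hmul {d : Module.End A₁ V₁ ⊗[R] Module.End A₂ V₂} (hd : φ d (v₁ ⊗ₜ v₂) ∈ W) :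
      p.unop * d = d := by
    have : MulOpposite.op d ∈ Ideal.span {p} := hI ▸ hd
    obtain ⟨y, hy⟩ := Ideal.mem_span_singleton'.mp this
    rw [← MulOpposite.unop_op d, ← hy, ← MulOpposite.unop_mul, mul_assoc, hp.eq]
  let P : V₁ ⊗[R] V₂ →ₗ[A₁ ⊗[R] A₂] V₁ ⊗[R] V₂ :=
    { toFun := φ p.unop
      map_add' := map_add _
      map_smul' := hφ _ }
  refine ⟨P.ker, LinearMap.IsProj.isCompl ⟨fun w ↦ ?_, fun w hw ↦ ?_⟩⟩
  · obtain ⟨a, rfl⟩ := exists_smul_tmul_eq hsmul h₁ h₂ w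
    rw [map_smul]
    exact W.smul_mem a hpI
  · obtain ⟨d, rfl⟩ := exists_finsupp_sum_endTensorEndToEnd_eq b c w
    have hd (k) (hk : k ∈ d.support) : p.unop * d k = d k := by
      refine hmul ?_
      obtain ⟨a₁, ha₁, ha₁'⟩ := IsSimpleModule.exists_smul_basis_eq b (d.support.image Prod.fst)
        k.1 v₁
      obtain ⟨a₂, ha₂, ha₂'⟩ := IsSimpleModule.exists_smul_basis_eq c (d.support.image Prod.snd)
        k.2 v₂
      convert W.smul_mem (a₁ ⊗ₜ a₂) hw
      rw [Finsupp.sum, Finset.smul_sum, Finset.sum_eq_single k]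
      · rw [← hφ, hsmul, ha₁, ha₂]
      · intro l hl hlk
        rw [← hφ, hsmul]
        by_cases h : l.1 = k.1
        · rw [ha₂' l.2 (Finset.mem_image_of_mem _ hl) fun h' ↦ hlk (Prod.ext h h'),
            TensorProduct.tmul_zero, map_zero]
        · rw [ha₁' l.1 (Finset.mem_image_of_mem _ hl) h, TensorProduct.zero_tmul, map_zero]
      · exact fun h ↦ absurd hk h
    rw [Finsupp.sum, map_sum]
    refine Finset.sum_congr rfl fun k hk ↦ ?_
    conv_rhs => rw [← hd k hk, map_mul]
    rfl
end

section
/- Finite Galois descent for vector spaces: let L/K be a finite Galois extension of fields with Galois group G = Gal(L/K), and let V be an L-vector space equipped with a family of maps r_σ : V → V for σ ∈ G such that r_id = id, r_{σ∘τ} = r_σ ∘ r_τ, and each r_σ is additive and σ-semilinear, i.e. r_σ(c • v) = σ(c) • r_σ(v) for all c ∈ L and v ∈ V. Let V^G = {v ∈ V : r_σ(v) = v for all σ ∈ G}, which is a K-subspace of V. Then the L-linear map L ⊗_K V^G → V sending c ⊗ v to c • v is bijective. -/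
open scoped TensorProduct

section

variable (K L : Type*) [Field K] [Field L] [Algebra K L] [FiniteDimensional K L] [IsGalois K L]

/-- A finite Galois extension has finite families `b` and `d` that are dual for the trace form. -/
theorem exists_dual_family_trace :
    ∃ (ι : Type) (_ : Fintype ι) (b d : ι → L),
      ∀ x : L, ∑ i, Algebra.trace K L (b i * x) • d i = x := by
  classical
  let b := Module.finBasis K L
  let d := (Algebra.traceForm K L).dualBasis (traceForm_nondegenerate K L) b
  refine ⟨_, inferInstance, b, d, fun x => ?_⟩
  conv_rhs => rw [← d.sum_repr x]
  refine Finset.sum_congr rfl fun i _ => ?_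
  rw [LinearMap.BilinForm.dualBasis_repr_apply, Algebra.traceForm_apply, mul_comm]

variable {K L}

/-- Families dual for the trace form are orthogonal to all nontrivial automorphisms. -/
theorem sum_dual_family_mul_apply [DecidableEq (L ≃ₐ[K] L)] {ι : Type*} [Fintype ι] {b d : ι → L}
    (hbd : ∀ x : L, ∑ i, Algebra.trace K L (b i * x) • d i = x) (σ : L ≃ₐ[K] L) :
    ∑ i, d i * σ (b i) = if σ = 1 then 1 else 0 := by
  have hli : LinearIndependent L (fun σ : L ≃ₐ[K] L => (σ : L → L)) :=
    (linearIndependent_monoidHom L L).comp (fun σ : L ≃ₐ[K] L => (σ : L →* L))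
      fun σ τ h => AlgEquiv.ext fun x => DFunLike.congr_fun h x
  have key := Fintype.linearIndependent_iff.mp hli
    (fun σ => ∑ i, d i * σ (b i) - if σ = 1 then 1 else 0) ?_ σ
  · exact sub_eq_zero.mp key
  · simp only [sub_smul, Finset.sum_sub_distrib, ite_smul, one_smul, zero_smul,
      Finset.sum_ite_eq', Finset.mem_univ, if_true, sub_eq_zero]
    ext x
    simp only [Finset.sum_apply, Pi.smul_apply, smul_eq_mul, AlgEquiv.one_apply]
    conv_rhs => rw [← hbd x]
    simp only [Finset.sum_mul, Algebra.smul_def, trace_eq_sum_automorphisms, map_mul]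
    rw [Finset.sum_comm]
    refine Fintype.sum_congr _ _ fun i => Fintype.sum_congr _ _ fun τ => ?_
    ring

end

/-- Finite Galois descent for vector spaces: if `L/K` is a finite Galois extension,
`V` an `L`-vector space with a semilinear action `r` of `Gal(L/K)` (i.e. `r 1 = id`,
`r (σ * τ) = r σ ∘ r τ`, each `r σ` additive and `σ`-semilinear), and `W` is the
`K`-subspace of `G`-fixed vectors, then the natural `L`-linear map
`L ⊗[K] W → V`, `c ⊗ w ↦ c • w`, is bijective. -/
theorem finite_galois_descent
    (K L : Type*) [Field K] [Field L] [Algebra K L]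
    [FiniteDimensional K L] [IsGalois K L]
    (V : Type*) [AddCommGroup V] [Module K V] [Module L V] [IsScalarTower K L V]
    (r : (L ≃ₐ[K] L) → V → V)
    (hone : ∀ v : V, r 1 v = v)
    (hmul : ∀ (σ τ : L ≃ₐ[K] L) (v : V), r (σ * τ) v = r σ (r τ v))
    (hadd : ∀ (σ : L ≃ₐ[K] L) (v w : V), r σ (v + w) = r σ v + r σ w)
    (hsmul : ∀ (σ : L ≃ₐ[K] L) (c : L) (v : V), r σ (c • v) = σ c • r σ v)
    (W : Submodule K V) (hW : ∀ v : V, v ∈ W ↔ ∀ σ : L ≃ₐ[K] L, r σ v = v) :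
    Function.Bijective (LinearMap.liftBaseChange L W.subtype : L ⊗[K] W →ₗ[L] V) := by
  classical
  obtain ⟨ι, _, b, d, hbd⟩ := exists_dual_family_trace K L
  let ρ (σ : L ≃ₐ[K] L) : V →+ V := AddMonoidHom.mk' (r σ) (hadd σ)
  have hfix (v : V) : (∑ σ, ρ σ) v ∈ W := by
    refine (hW _).mpr fun τ => ?_
    change ρ τ _ = _
    simp only [AddMonoidHom.finsetSum_apply, map_sum]
    exact Fintype.sum_equiv (Equiv.mulLeft τ) _ _ fun σ => (hmul τ σ v).symm
  let T : V →+ W := (∑ σ, ρ σ).codRestrict W hfix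
  have hT (c : L) (v : V) : (T (c • v) : V) = ∑ σ : L ≃ₐ[K] L, σ c • r σ v := by
    change (∑ σ, ρ σ) (c • v) = _
    rw [AddMonoidHom.finsetSum_apply]
    exact Finset.sum_congr rfl fun σ _ => hsmul σ c v
  have hTW (c : L) (w : W) : T (c • (w : V)) = Algebra.trace K L c • w := by
    ext
    rw [hT, Submodule.coe_smul, ← algebraMap_smul L, trace_eq_sum_automorphisms, Finset.sum_smul]
    exact Finset.sum_congr rfl fun σ _ => by rw [(hW w).mp w.2 σ]
  refine Function.bijective_iff_has_inverse.mpr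
    ⟨fun v => ∑ i, d i ⊗ₜ[K] T (b i • v), fun x => ?_, fun v => ?_⟩
  · induction x with
    | zero => simp
    | add x y hx hy =>
      simpa only [map_add, smul_add, TensorProduct.tmul_add, Finset.sum_add_distrib]
        using congrArg₂ (· + ·) hx hy
    | tmul c w =>
      simp only [LinearMap.liftBaseChange_tmul, Submodule.subtype_apply, smul_smul, hTW,
        ← TensorProduct.smul_tmul, ← TensorProduct.sum_tmul, hbd]
  · simp only [map_sum, LinearMap.liftBaseChange_tmul, Submodule.subtype_apply, hT,
      Finset.smul_sum, smul_smul]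
    rw [Finset.sum_comm]
    simp only [← Finset.sum_smul, sum_dual_family_mul_apply hbd, ite_smul, one_smul, zero_smul,
      Finset.sum_ite_eq', Finset.mem_univ, if_true, hone]
end

section
/- Infinite (smooth) Galois descent: let L/K be a Galois algebraic field extension (possibly of infinite degree) with Galois group G = Gal(L/K) = L ≃ₐ[K] L, and let V be an L-vector space equipped with maps r_σ : V → V for σ ∈ G such that r_id = id, r_{σ∘τ} = r_σ ∘ r_τ, and each r_σ is additive and σ-semilinear (r_σ(c • v) = σ(c) • r_σ(v)). Assume the action is smooth: for every v ∈ V there exists an intermediate field K ⊆ M ⊆ L with [M : K] finite such that every σ ∈ G fixing M pointwise satisfies r_σ(v) = v. Let V^G = {v ∈ V : r_σ(v) = v for all σ ∈ G}. Then the L-linear map L ⊗_K V^G → V sending c ⊗ v to c • v is bijective. -/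
open scoped TensorProduct

section SemilinearAction

variable {K L V : Type*} [Field K] [Field L] [Algebra K L] [IsGalois K L]
  [AddCommGroup V] [Module L V]
  {ρ : (L ≃ₐ[K] L) →* AddMonoid.End V}

/-- A family of vectors fixed by a semilinear Galois action that is linearly independent over the
base field is linearly independent over the extension. -/
theorem LinearIndependent.of_forall_fixed [Module K V] [IsScalarTower K L V]
    (hρ : ∀ (σ : L ≃ₐ[K] L) (c : L) (v : V), ρ σ (c • v) = σ c • ρ σ v)
    {ι : Type*} {w : ι → V} (hw : ∀ σ i, ρ σ (w i) = w i) (hK : LinearIndependent K w) :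
    LinearIndependent L w := by
  classical
  have key (s : Finset ι) : LinearIndepOn L w (s : Set ι) := by
    induction s using Finset.induction_on with
    | empty => simp
    | insert i s hi ih =>
      rw [Finset.coe_insert, linearIndepOn_insert (by simpa using hi)]
      refine ⟨ih, fun hmem ↦ ?_⟩
      obtain ⟨c, hc⟩ := (Submodule.mem_span_image_finset_iff_exists_fun L).1 hmem
      have hfix (j : s) (σ : L ≃ₐ[K] L) : σ (c j) = c j := by
        refine sub_eq_zero.1 (Fintype.linearIndependent_iff.1 ih (fun j ↦ σ (c j) - c j) ?_ j)
        have hσ := congrArg (ρ σ) hc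
        simp only [map_sum, hρ, hw] at hσ
        simp only [sub_smul, Finset.sum_sub_distrib]
        exact sub_eq_zero.2 (hσ.trans hc.symm)
      choose a ha using fun j ↦ (InfiniteGalois.mem_range_algebraMap_iff_fixed (c j)).2 (hfix j)
      refine ((linearIndepOn_insert (by simpa using hi)).1 (hK.linearIndepOn (insert i ↑s))).2
        ((Submodule.mem_span_image_finset_iff_exists_fun K).2 ⟨a, ?_⟩)
      simpa only [← ha, algebraMap_smul] using hc
  exact linearIndependent_iff'.2 fun s ↦ linearIndepOn_finset_iff.1 (key s)

/-- The trace argument: a vector fixed by `Gal(L/M)`, with `M` finite over `K`, is an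
`L`-linear combination of vectors fixed by the whole Galois group. -/
theorem mem_span_fixed_of_fixed_by_fixingSubgroup
    (hρ : ∀ (σ : L ≃ₐ[K] L) (c : L) (v : V), ρ σ (c • v) = σ c • ρ σ v)
    (M : IntermediateField K L) [FiniteDimensional K M] {v : V}
    (hv : ∀ σ ∈ M.fixingSubgroup, ρ σ v = v) :
    v ∈ Submodule.span L {w : V | ∀ σ, ρ σ w = w} := by
  have hlift (f : M →ₐ[K] L) : ∃ σ : L ≃ₐ[K] L, ∀ x : M, σ x = f x :=
    ⟨AlgEquiv.ofBijective (f.liftNormal L) (AlgHom.normal_bijective K L L _),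
      fun x ↦ f.liftNormal_commutes L x⟩
  choose e he using hlift
  have hcongr (σ τ : L ≃ₐ[K] L) (h : ∀ x : M, σ x = τ x) : ρ σ v = ρ τ v := by
    have hfix : ρ (τ⁻¹ * σ) v = v := by
      refine hv _ ((IntermediateField.mem_fixingSubgroup_iff _ _).2 fun x hx ↦ ?_)
      rw [AlgEquiv.mul_apply, h ⟨x, hx⟩]
      exact τ.symm_apply_apply x
    calc ρ σ v = ρ (τ * (τ⁻¹ * σ)) v := by rw [mul_inv_cancel_left]
      _ = ρ τ v := by rw [map_mul, AddMonoid.End.coe_mul, Function.comp_apply, hfix]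
  have htrace (a : M) (σ : L ≃ₐ[K] L) :
      ρ σ (∑ f : M →ₐ[K] L, f a • ρ (e f) v) = ∑ f : M →ₐ[K] L, f a • ρ (e f) v := by
    rw [map_sum]
    refine Fintype.sum_equiv (AlgEquiv.arrowCongr AlgEquiv.refl σ) _ _ fun f ↦ ?_
    rw [hρ, ← Function.comp_apply (f := ρ σ), ← AddMonoid.End.coe_mul, ← map_mul]
    congr 1
    exact hcongr _ _ fun x ↦ by simp [he]
  by_contra hmem
  obtain ⟨φ, hφv, hφ⟩ := Submodule.exists_le_ker_of_notMem hmem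
  have hzero : φ (ρ (e M.val) v) = 0 := by
    refine Fintype.linearIndependent_iff.1 (linearIndependent_toLinearMap K M L)
      (fun f ↦ φ (ρ (e f) v)) (LinearMap.ext fun a ↦ ?_) M.val
    have := hφ (Submodule.subset_span (htrace a))
    simpa [mul_comm] using this
  rw [hcongr (e M.val) 1 fun x ↦ by simp [he], map_one] at hzero
  exact hφv hzero

end SemilinearAction

/-- Infinite (smooth) Galois descent: if `L/K` is a (possibly infinite) Galois algebraic
field extension, `V` an `L`-vector space with a semilinear action `r` of `Gal(L/K)` that
is smooth (every vector is fixed by `Gal(L/M)` for some intermediate field `M` finite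
over `K`), and `W` is the `K`-subspace of fixed vectors, then the natural `L`-linear map
`L ⊗[K] W → V`, `c ⊗ w ↦ c • w`, is bijective. -/
theorem smooth_galois_descent
    (K L : Type*) [Field K] [Field L] [Algebra K L]
    [Algebra.IsAlgebraic K L] [IsGalois K L]
    (V : Type*) [AddCommGroup V] [Module K V] [Module L V] [IsScalarTower K L V]
    (r : (L ≃ₐ[K] L) → V → V)
    (hone : ∀ v : V, r 1 v = v)
    (hmul : ∀ (σ τ : L ≃ₐ[K] L) (v : V), r (σ * τ) v = r σ (r τ v))
    (hadd : ∀ (σ : L ≃ₐ[K] L) (v w : V), r σ (v + w) = r σ v + r σ w)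
    (hsmul : ∀ (σ : L ≃ₐ[K] L) (c : L) (v : V), r σ (c • v) = σ c • r σ v)
    (hsmooth : ∀ v : V, ∃ M : IntermediateField K L, FiniteDimensional K M ∧
      ∀ σ : L ≃ₐ[K] L, (∀ x ∈ M, σ x = x) → r σ v = v)
    (W : Submodule K V) (hW : ∀ v : V, v ∈ W ↔ ∀ σ : L ≃ₐ[K] L, r σ v = v) :
    Function.Bijective (LinearMap.liftBaseChange L W.subtype : L ⊗[K] W →ₗ[L] V) := by
  let ρ : (L ≃ₐ[K] L) →* AddMonoid.End V :=
    { toFun := fun σ ↦ AddMonoidHom.mk' (r σ) (hadd σ)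
      map_one' := AddMonoidHom.ext hone
      map_mul' := fun σ τ ↦ AddMonoidHom.ext (hmul σ τ) }
  have hρ : ∀ (σ : L ≃ₐ[K] L) (c : L) (v : V), ρ σ (c • v) = σ c • ρ σ v := hsmul
  constructor
  · let b := Module.Basis.ofVectorSpace K W
    have hb : LinearIndependent L (fun i ↦ (b i : V)) :=
      LinearIndependent.of_forall_fixed hρ (fun σ i ↦ (hW _).1 (b i).2 σ)
        (b.linearIndependent.map' W.subtype W.ker_subtype)
    have hcomp : (LinearMap.liftBaseChange L W.subtype : L ⊗[K] W →ₗ[L] V) =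
        (Finsupp.linearCombination L fun i ↦ (b i : V)) ∘ₗ
          (Algebra.TensorProduct.basis L b).repr.toLinearMap :=
      (Algebra.TensorProduct.basis L b).ext fun i ↦ by simp
    rw [hcomp, LinearMap.coe_comp]
    exact Function.Injective.comp hb (Algebra.TensorProduct.basis L b).repr.injective
  · rw [← LinearMap.range_eq_top, eq_top_iff]
    intro v _
    obtain ⟨M, hM, hv⟩ := hsmooth v
    have hspan := mem_span_fixed_of_fixed_by_fixingSubgroup hρ M (v := v) fun σ hσ ↦
      hv σ ((IntermediateField.mem_fixingSubgroup_iff _ _).1 hσ)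
    refine Submodule.span_le.2 (fun w hw ↦ ?_) hspan
    exact ⟨1 ⊗ₜ ⟨w, (hW w).2 hw⟩, by simp⟩
end

section
/- Let L/K be a finite Galois extension of fields with Galois group G = Gal(L/K). Consider the K-linear map Φ from the space of functions G → L to the space of K-linear endomorphisms of L, defined by Φ(f)(x) = Σ_{σ ∈ G} f(σ) · σ(x) for x ∈ L. Then Φ is bijective, and moreover Φ(f ⋆ g) = Φ(f) ∘ Φ(g) for all f, g : G → L, where the twisted convolution product is defined by (f ⋆ g)(ρ) = Σ_{(σ,τ) : σ∘τ = ρ} f(σ) · σ(g(τ)). (This is the isomorphism between the twisted group algebra L'[G] and End_K(L).) -/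
open scoped Classical

/-- The map `Φ` from functions `Gal(L/K) → L` to `K`-linear endomorphisms of `L`,
`Φ(f)(x) = Σ_σ f(σ) · σ(x)`. -/
noncomputable def galoisPhi (K L : Type*) [Field K] [Field L] [Algebra K L]
    [FiniteDimensional K L] (f : (L ≃ₐ[K] L) → L) : L →ₗ[K] L :=
  ∑ σ : L ≃ₐ[K] L, f σ • (σ.toLinearMap : L →ₗ[K] L)

/-- The twisted convolution product `(f ⋆ g)(ρ) = Σ_{(σ,τ) : σ∘τ = ρ} f(σ) · σ(g(τ))`,
i.e. the multiplication of the twisted group algebra `L'[Gal(L/K)]`. -/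
noncomputable def twistedConv (K L : Type*) [Field K] [Field L] [Algebra K L]
    [FiniteDimensional K L] (f g : (L ≃ₐ[K] L) → L) : (L ≃ₐ[K] L) → L :=
  fun ρ => ∑ p ∈ Finset.univ.filter
      (fun p : (L ≃ₐ[K] L) × (L ≃ₐ[K] L) => p.1 * p.2 = ρ),
    f p.1 * p.1 (g p.2)

theorem galoisPhi_apply (K L : Type*) [Field K] [Field L] [Algebra K L]
    [FiniteDimensional K L] (f : (L ≃ₐ[K] L) → L) (x : L) :
    galoisPhi K L f x = ∑ σ : L ≃ₐ[K] L, f σ * σ x := by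
  simp [galoisPhi, LinearMap.sum_apply]

/-- **Dedekind's lemma** for automorphisms, viewed as linear endomorphisms. -/
theorem linearIndependent_algEquiv_toLinearMap (K L : Type*) [Field K] [Field L] [Algebra K L] :
    LinearIndependent L (fun σ : L ≃ₐ[K] L => (σ.toLinearMap : L →ₗ[K] L)) :=
  (linearIndependent_toLinearMap K L L).comp (fun σ : L ≃ₐ[K] L => (σ : L →ₐ[K] L))
    fun _ _ h => AlgEquiv.coe_toAlgHom_injective h

theorem galoisPhi_bijective (K L : Type*) [Field K] [Field L] [Algebra K L]
    [FiniteDimensional K L] [IsGalois K L] : Function.Bijective (galoisPhi K L) := by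
  have hcard : Fintype.card (L ≃ₐ[K] L) = Module.finrank L (L →ₗ[K] L) := by
    rw [Module.finrank_linearMap_self, ← Nat.card_eq_fintype_card,
      IsGalois.card_aut_eq_finrank]
  let b := basisOfLinearIndependentOfCardEqFinrank
    (linearIndependent_algEquiv_toLinearMap K L) hcard
  have hb : galoisPhi K L = b.equivFun.symm := by
    funext f
    simp [b, galoisPhi, Module.Basis.equivFun_symm_apply]
  rw [hb]
  exact b.equivFun.symm.bijective

theorem galoisPhi_twistedConv (K L : Type*) [Field K] [Field L] [Algebra K L]
    [FiniteDimensional K L] (f g : (L ≃ₐ[K] L) → L) :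
    galoisPhi K L (twistedConv K L f g) = galoisPhi K L f ∘ₗ galoisPhi K L g := by
  ext x
  calc galoisPhi K L (twistedConv K L f g) x
      = ∑ ρ : L ≃ₐ[K] L, ∑ p : (L ≃ₐ[K] L) × (L ≃ₐ[K] L) with p.1 * p.2 = ρ,
          f p.1 * p.1 (g p.2) * (p.1 * p.2) x := by
        rw [galoisPhi_apply]
        refine Finset.sum_congr rfl fun ρ _ => ?_
        rw [twistedConv, Finset.sum_mul]
        refine Finset.sum_congr rfl fun p hp => ?_
        rw [(Finset.mem_filter.mp hp).2]
    _ = ∑ p : (L ≃ₐ[K] L) × (L ≃ₐ[K] L), f p.1 * p.1 (g p.2) * (p.1 * p.2) x :=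
        Finset.sum_fiberwise _ _ _
    _ = (galoisPhi K L f ∘ₗ galoisPhi K L g) x := by
        simp only [LinearMap.comp_apply, galoisPhi_apply, Fintype.sum_prod_type,
          map_sum, map_mul, AlgEquiv.mul_apply, mul_assoc]
        exact Finset.sum_comm

/-- For a finite Galois extension `L/K` with `G = Gal(L/K)`, the map
`Φ : (G → L) → End_K(L)`, `Φ(f)(x) = Σ_σ f(σ)·σ(x)`, is bijective and intertwines the
twisted convolution with composition: the twisted group algebra `L'[G]` is isomorphic
to `End_K(L)`. -/
theorem twisted_group_algebra_iso_end
    (K L : Type*) [Field K] [Field L] [Algebra K L]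
    [FiniteDimensional K L] [IsGalois K L] :
    Function.Bijective (galoisPhi K L) ∧
      ∀ f g : (L ≃ₐ[K] L) → L,
        galoisPhi K L (twistedConv K L f g) = (galoisPhi K L f) ∘ₗ (galoisPhi K L g) := by
  exact ⟨galoisPhi_bijective K L, galoisPhi_twistedConv K L⟩
end

section
/- Let n be a positive integer, let L = ℚ(ζ_n) be the n-th cyclotomic field over ℚ, let ζ ∈ L be a primitive n-th root of unity, and let τ : L ≃ₐ[ℚ] L be a ℚ-algebra automorphism of L satisfying τ(ζ) = ζ⁻¹. Then there is no element λ ∈ L with λ · τ(λ) = -1. (Under any embedding of L into ℂ, τ corresponds to complex conjugation, so λ·τ(λ) maps to |λ|² ≥ 0; this is the norm obstruction showing the odd part of the Weil representation does not descend past the CM field ℚ(ζ_{p^k}).) -/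
/-- An automorphism of the `n`-th cyclotomic field inverting a primitive `n`-th root of unity
corresponds to complex conjugation under every complex embedding. -/
theorem embedding_apply_eq_conj_of_apply_eq_inv {n : ℕ} [NeZero n] {L : Type*} [Field L]
    [Algebra ℚ L] [IsCyclotomicExtension {n} ℚ L] {ζ : L} (hζ : IsPrimitiveRoot ζ n)
    {τ : L ≃ₐ[ℚ] L} (hτ : τ ζ = ζ⁻¹) (φ : L →ₐ[ℚ] ℂ) (x : L) :
    φ (τ x) = starRingEnd ℂ (φ x) := by
  have hext : φ.comp τ.toAlgHom = (Complex.conjAe.toAlgHom.restrictScalars ℚ).comp φ := by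
    refine (hζ.powerBasis ℚ).algHom_ext ?_
    have hnorm : ‖φ ζ‖ = 1 := (hζ.map_of_injective φ.injective).norm'_eq_one (NeZero.ne n)
    simpa [hτ] using Complex.inv_eq_conj hnorm
  exact DFunLike.congr_fun hext x

/-- Let `L = ℚ(ζₙ)` be the `n`-th cyclotomic field, `ζ` a primitive `n`-th root of unity
in `L`, and `τ` the ℚ-automorphism of `L` with `τ(ζ) = ζ⁻¹` (complex conjugation).
Then there is no `λ ∈ L` with `λ · τ(λ) = -1`. This is the norm obstruction showing the
odd part of the Weil representation does not descend past the CM field. -/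
theorem no_element_of_conjugate_norm_neg_one
    (n : ℕ+) (ζ : CyclotomicField n ℚ) (hζ : IsPrimitiveRoot ζ (n : ℕ))
    (τ : CyclotomicField n ℚ ≃ₐ[ℚ] CyclotomicField n ℚ) (hτ : τ ζ = ζ⁻¹) :
    ¬ ∃ lam : CyclotomicField n ℚ, lam * τ lam = -1 := by
  rintro ⟨lam, hlam⟩
  have : IsCyclotomicExtension {(n : ℕ)} ℚ (CyclotomicField n ℚ) :=
    CyclotomicField.isCyclotomicExtension n ℚ
  let φ : CyclotomicField n ℚ →ₐ[ℚ] ℂ := IsAlgClosed.lift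
  have h : (Complex.normSq (φ lam) : ℂ) = ((-1 : ℝ) : ℂ) := by
    rw [← Complex.mul_conj, ← embedding_apply_eq_conj_of_apply_eq_inv hζ hτ φ, ← map_mul, hlam]
    simp
  linarith [Complex.normSq_nonneg (φ lam), Complex.ofReal_injective h]
end

section
/- Uniqueness of the irreducible model over the base field: let R be a perfect field with algebraic closure R̄ and G a group. Let ρ : G → GL_d(R̄) be a homomorphism whose associated module is simple. Suppose π : G → GL_N(R) and π' : G → GL_{N'}(R) are homomorphisms whose associated modules (R^N and R^{N'}) are simple, and suppose there exist a nonzero d × N matrix T over R̄ with T·π(g) = ρ(g)·T for all g ∈ G and a nonzero d × N' matrix T' over R̄ with T'·π'(g) = ρ(g)·T' for all g ∈ G (i.e. ρ occurs as a quotient of both base changes π ⊗_R R̄ and π' ⊗_R R̄). Then N = N' and there exists Q ∈ GL_N(R) with π'(g) = Q·π(g)·Q⁻¹ for all g ∈ G. -/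
open Matrix

/-- If a module is spanned by the images of maps out of a simple module `V`, then every simple
module mapping nontrivially to it is isomorphic to `V`. -/
theorem nonempty_linearEquiv_of_iSup_range_eq_top {A V V' M ι : Type*} [Ring A]
    [AddCommGroup V] [Module A V] [AddCommGroup V'] [Module A V'] [AddCommGroup M] [Module A M]
    [IsSimpleModule A V] [IsSimpleModule A V'] (f : ι → V →ₗ[A] M)
    (hf : ⨆ i, LinearMap.range (f i) = ⊤) (f' : V' →ₗ[A] M) (hf' : f' ≠ 0) :
    Nonempty (V ≃ₗ[A] V') := by
  have : IsSemisimpleModule A M :=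
    isSemisimpleModule_of_isSemisimpleModule_submodule' (fun i ↦ .range (f i)) hf
  obtain ⟨p, hp⟩ := IsSemisimpleModule.extension_property f'
    ((LinearMap.injective_or_eq_zero f').resolve_right hf') LinearMap.id
  by_contra h
  have hzero (i : ι) : p ∘ₗ f i = 0 :=
    (LinearMap.bijective_or_eq_zero (p ∘ₗ f i)).resolve_left
      fun hb ↦ h ⟨LinearEquiv.ofBijective _ hb⟩
  have hker : ⊤ ≤ LinearMap.ker p :=
    hf ▸ iSup_le fun i ↦ LinearMap.range_le_ker_iff.mpr (hzero i)
  have hp0 : p = 0 := LinearMap.ker_eq_top.mp (top_le_iff.mp hker)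
  obtain ⟨v, hv⟩ := @exists_ne V' (IsSimpleModule.nontrivial A V') 0
  exact hv (by simpa [hp0] using (LinearMap.congr_fun hp v).symm)

/-- If a representation is generated by the images of intertwining maps out of an irreducible
representation `σ`, then every irreducible representation mapping nontrivially to it is isomorphic
to `σ`. -/
theorem Representation.nonempty_equiv_of_generates {k G V V' M ι : Type*} [Field k] [Monoid G]
    [AddCommGroup V] [Module k V] [AddCommGroup V'] [Module k V'] [AddCommGroup M] [Module k M]
    {σ : Representation k G V} {σ' : Representation k G V'} {τ : Representation k G M}
    [σ.IsIrreducible] [σ'.IsIrreducible] (f : ι → IntertwiningMap σ τ)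
    (hf : ∀ W : Subrepresentation τ, (∀ i v, f i v ∈ W) → W = ⊤)
    (f' : IntertwiningMap σ' τ) (hf' : f' ≠ 0) :
    Nonempty (σ.Equiv σ') := by
  have hspan : ⨆ i, LinearMap.range (IntertwiningMap.equivLinearMapAsModule σ τ (f i)) = ⊤ := by
    rw [← map_eq_top_iff (f := Subrepresentation.subrepresentationSubmoduleOrderIso.symm)]
    exact hf _ fun i v ↦ Submodule.mem_iSup_of_mem (p := fun i ↦
      LinearMap.range (IntertwiningMap.equivLinearMapAsModule σ τ (f i))) i ⟨v, rfl⟩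
  obtain ⟨e⟩ := nonempty_linearEquiv_of_iSup_range_eq_top _ hspan
    (IntertwiningMap.equivLinearMapAsModule σ' τ f') (by simpa using hf')
  exact ⟨((IntertwiningMap.equivLinearMapAsModule σ σ').symm e.toLinearMap).ofBijective
    e.bijective⟩

section MatrixRepresentation

variable {k K G m n : Type*} [Field k] [Field K] [Algebra k K] [Monoid G]
  [Fintype m] [DecidableEq m] [Fintype n] [DecidableEq n]

/-- The `k`-linear representation on `n → K` given by invertible matrices over an extension `K`
of `k`. -/
def Matrix.unitsRepresentation (k : Type*) [Field k] [Algebra k K]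
    (π : G →* (Matrix n n K)ˣ) : Representation k G (n → K) where
  toFun g := (π g).val.mulVecLin.restrictScalars k
  map_one' := by ext; simp
  map_mul' g h := by ext; simp

@[simp]
theorem Matrix.unitsRepresentation_apply (π : G →* (Matrix n n K)ˣ) (g : G) (v : n → K) :
    Matrix.unitsRepresentation k π g v = (π g).val *ᵥ v := rfl

theorem Matrix.unitsRepresentation_isIrreducible [Nonempty n] (π : G →* (Matrix n n k)ˣ)
    (hπ : ∀ W : Submodule k (n → k),
      (∀ g : G, ∀ v ∈ W, (π g).val *ᵥ v ∈ W) → W = ⊥ ∨ W = ⊤) :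
    (Matrix.unitsRepresentation k π).IsIrreducible where
  exists_pair_ne := ⟨⊥, ⊤, fun h ↦
    bot_ne_top (congrArg Subrepresentation.toSubmodule h : (⊥ : Submodule k (n → k)) = ⊤)⟩
  eq_bot_or_eq_top W :=
    (hπ W.toSubmodule fun g _ hv ↦ W.apply_mem_toSubmodule g hv).imp
      (fun h ↦ Subrepresentation.toSubmodule_injective h)
      (fun h ↦ Subrepresentation.toSubmodule_injective h)

/-- The scalar multiple by `c` of the intertwining map `v ↦ T v` attached to a matrix `T` over
`K` intertwining a representation over `k` with one over `K`. -/
def Matrix.intertwiningMap (π : G →* (Matrix n n k)ˣ) (ρ : G →* (Matrix m m K)ˣ)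
    (T : Matrix m n K) (hT : ∀ g, T * (π g).val.map (algebraMap k K) = (ρ g).val * T) (c : K) :
    Representation.IntertwiningMap (Matrix.unitsRepresentation k π)
      (Matrix.unitsRepresentation k ρ) where
  toLinearMap := c • (T.mulVecLin.restrictScalars k ∘ₗ (Algebra.linearMap k K).compLeft n)
  isIntertwining' g := by
    refine LinearMap.ext fun v ↦ ?_
    have hv : algebraMap k K ∘ ((π g).val *ᵥ v)
        = (π g).val.map (algebraMap k K) *ᵥ (algebraMap k K ∘ v) :=
      funext fun i ↦ RingHom.map_mulVec _ _ _ i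
    change c • T *ᵥ (algebraMap k K ∘ ((π g).val *ᵥ v))
      = (ρ g).val *ᵥ (c • T *ᵥ (algebraMap k K ∘ v))
    rw [hv, Matrix.mulVec_smul, Matrix.mulVec_mulVec, Matrix.mulVec_mulVec, hT]

theorem Matrix.intertwiningMap_apply (π : G →* (Matrix n n k)ˣ) (ρ : G →* (Matrix m m K)ˣ)
    (T : Matrix m n K) (hT : ∀ g, T * (π g).val.map (algebraMap k K) = (ρ g).val * T) (c : K)
    (v : n → k) :
    Matrix.intertwiningMap π ρ T hT c v = c • T *ᵥ (algebraMap k K ∘ v) := rfl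

theorem Matrix.intertwiningMap_single (π : G →* (Matrix n n k)ˣ) (ρ : G →* (Matrix m m K)ˣ)
    (T : Matrix m n K) (hT : ∀ g, T * (π g).val.map (algebraMap k K) = (ρ g).val * T) (c : K)
    (j : n) :
    Matrix.intertwiningMap π ρ T hT c (Pi.single j 1) = c • T.col j := by
  have h : algebraMap k K ∘ (Pi.single j 1 : n → k) = Pi.single j 1 := by
    ext i
    simp [Pi.single_apply, apply_ite (algebraMap k K)]
  rw [Matrix.intertwiningMap_apply, h, Matrix.mulVec_single_one]

/-- Two irreducible matrix representations over `k` having a common irreducible quotient over an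
extension field `K` are isomorphic. -/
theorem Matrix.nonempty_equiv_of_intertwining {n' : Type*} [Fintype n'] [DecidableEq n']
    (ρ : G →* (Matrix m m K)ˣ)
    (hρ : ∀ W : Submodule K (m → K),
      (∀ g : G, ∀ v ∈ W, (ρ g).val *ᵥ v ∈ W) → W = ⊥ ∨ W = ⊤)
    (π : G →* (Matrix n n k)ˣ)
    (hπ : ∀ W : Submodule k (n → k),
      (∀ g : G, ∀ v ∈ W, (π g).val *ᵥ v ∈ W) → W = ⊥ ∨ W = ⊤)
    (π' : G →* (Matrix n' n' k)ˣ)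
    (hπ' : ∀ W : Submodule k (n' → k),
      (∀ g : G, ∀ v ∈ W, (π' g).val *ᵥ v ∈ W) → W = ⊥ ∨ W = ⊤)
    (T : Matrix m n K) (hT : T ≠ 0)
    (hTint : ∀ g, T * (π g).val.map (algebraMap k K) = (ρ g).val * T)
    (T' : Matrix m n' K) (hT' : T' ≠ 0)
    (hT'int : ∀ g, T' * (π' g).val.map (algebraMap k K) = (ρ g).val * T') :
    Nonempty ((Matrix.unitsRepresentation k π).Equiv (Matrix.unitsRepresentation k π')) := by
  have : Nonempty n := not_isEmpty_iff.mp fun _ ↦ hT (Subsingleton.elim _ _)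
  have : Nonempty n' := not_isEmpty_iff.mp fun _ ↦ hT' (Subsingleton.elim _ _)
  have := Matrix.unitsRepresentation_isIrreducible π hπ
  have := Matrix.unitsRepresentation_isIrreducible π' hπ'
  have hrange : LinearMap.range T.mulVecLin = ⊤ := by
    refine (hρ _ ?_).resolve_left fun h ↦ hT ?_
    · rintro g _ ⟨u, rfl⟩
      exact ⟨(π g).val.map (algebraMap k K) *ᵥ u, by simp [Matrix.mulVec_mulVec, hTint]⟩
    · exact Matrix.toLin'.map_eq_zero_iff.mp (LinearMap.range_eq_bot.mp h)
  refine Representation.nonempty_equiv_of_generates (Matrix.intertwiningMap π ρ T hTint)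
    (fun W hW ↦ ?_) (Matrix.intertwiningMap π' ρ T' hT'int 1) fun h ↦ hT' ?_
  · refine top_le_iff.mp fun x _ ↦ ?_
    obtain ⟨u, rfl⟩ : x ∈ LinearMap.range T.mulVecLin := hrange ▸ Submodule.mem_top
    have hu : T.mulVecLin u = ∑ j, u j • T.col j := by
      ext i
      simp [Matrix.mulVec, dotProduct, mul_comm]
    rw [hu]
    exact Submodule.sum_mem W.toSubmodule fun j _ ↦
      Matrix.intertwiningMap_single π ρ T hTint (u j) j ▸ hW (u j) (Pi.single j 1)
  · ext i j
    have hj := Matrix.intertwiningMap_single π' ρ T' hT'int 1 j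
    rw [h] at hj
    simpa using (congrFun hj i).symm

end MatrixRepresentation


/-- Uniqueness of the irreducible model over the base field: let `R` be a perfect field
with algebraic closure `R̄`, `ρ : G → GL_dd(R̄)` with simple associated module, and let
`π : G → GL_N(R)`, `π' : G → GL_{N'}(R)` have simple associated modules such that `ρ`
occurs as a quotient of both base changes (witnessed by nonzero intertwiners `T`, `T'`
over `R̄`). Then `N = N'` and `π` and `π'` are conjugate by some `Q ∈ GL_N(R)`. -/
theorem unique_irreducible_model_over_base_field
    (R : Type*) [Field R] [PerfectField R] (G : Type*) [Group G]
    (dd N N' : ℕ)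
    (ρ : G →* (Matrix (Fin dd) (Fin dd) (AlgebraicClosure R))ˣ)
    (hρ : ∀ W : Submodule (AlgebraicClosure R) (Fin dd → AlgebraicClosure R),
      (∀ g : G, ∀ v ∈ W, (ρ g).val.mulVec v ∈ W) → W = ⊥ ∨ W = ⊤)
    (π : G →* (Matrix (Fin N) (Fin N) R)ˣ)
    (hπ : ∀ W : Submodule R (Fin N → R),
      (∀ g : G, ∀ v ∈ W, (π g).val.mulVec v ∈ W) → W = ⊥ ∨ W = ⊤)
    (π' : G →* (Matrix (Fin N') (Fin N') R)ˣ)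
    (hπ' : ∀ W : Submodule R (Fin N' → R),
      (∀ g : G, ∀ v ∈ W, (π' g).val.mulVec v ∈ W) → W = ⊥ ∨ W = ⊤)
    (T : Matrix (Fin dd) (Fin N) (AlgebraicClosure R)) (hT : T ≠ 0)
    (hTint : ∀ g : G,
      T * ((π g).val.map (algebraMap R (AlgebraicClosure R))) = (ρ g).val * T)
    (T' : Matrix (Fin dd) (Fin N') (AlgebraicClosure R)) (hT' : T' ≠ 0)
    (hT'int : ∀ g : G,
      T' * ((π' g).val.map (algebraMap R (AlgebraicClosure R))) = (ρ g).val * T') :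
    ∃ h : N = N', ∃ Q : (Matrix (Fin N) (Fin N) R)ˣ,
      ∀ g : G, Matrix.reindex (finCongr h).symm (finCongr h).symm (π' g).val
        = Q.val * (π g).val * (Q⁻¹).val := by
  obtain ⟨e⟩ := Matrix.nonempty_equiv_of_intertwining ρ hρ π hπ π' hπ' T hT hTint T' hT' hT'int
  obtain rfl : N = N' := by simpa using e.toLinearEquiv.finrank_eq
  refine ⟨rfl, Units.map LinearMap.toMatrixAlgEquiv'.toMonoidHom
    (LinearMap.GeneralLinearGroup.ofLinearEquiv e.toLinearEquiv), fun g ↦ ?_⟩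
  rw [Units.eq_mul_inv_iff_mul_eq]
  refine Matrix.toLinAlgEquiv'.injective (LinearMap.ext fun v ↦ ?_)
  simpa using (e.toIntertwiningMap.isIntertwining _ _ g v).symm
end

section
/- Let K be a field, let E/K be a finite separable field extension of degree n, and let L/K be a field extension such that there are exactly n distinct K-algebra homomorphisms from E to L (for instance, L algebraically closed, or L normal over K containing an isomorphic copy of E). Then the L-algebra homomorphism E ⊗_K L → ∏_{φ ∈ Hom_{K-alg}(E, L)} L, defined on pure tensors by e ⊗ c ↦ (φ(e) · c)_{φ}, is an isomorphism of L-algebras. -/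
open scoped TensorProduct

attribute [local instance] Algebra.TensorProduct.rightAlgebra

/-- Dedekind's independence of characters, dually: the vectors `(φ e)_φ` span `∏_φ L`. -/
theorem span_range_algHom_apply_eq_top (K E L : Type*) [Field K] [Field E] [Field L]
    [Algebra K E] [Algebra K L] [Finite (E →ₐ[K] L)] :
    Submodule.span L (Set.range fun (e : E) (φ : E →ₐ[K] L) => φ e) = ⊤ := by
  classical
  have := Fintype.ofFinite (E →ₐ[K] L)
  by_contra hne
  obtain ⟨f, hf, hle⟩ := Submodule.exists_le_ker_of_lt_top _ (lt_top_iff_ne_top.mpr hne)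
  have hsum : ∑ φ : E →ₐ[K] L, f (fun ψ => if φ = ψ then 1 else 0) • φ.toLinearMap = 0 := by
    ext e
    have he : f (fun φ : E →ₐ[K] L => φ e) = 0 :=
      hle (Submodule.subset_span (Set.mem_range_self e))
    rw [LinearMap.pi_apply_eq_sum_univ f] at he
    simpa [LinearMap.sum_apply, mul_comm] using he
  have hzero := Fintype.linearIndependent_iff.mp (linearIndependent_toLinearMap K E L) _ hsum
  exact hf (LinearMap.ext fun v => by simp [LinearMap.pi_apply_eq_sum_univ f v, hzero])

/-- Let `E/K` be a finite separable extension of degree `n` and `L/K` a field extension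
admitting exactly `n` distinct `K`-algebra homomorphisms `E → L`. Then the `L`-algebra
homomorphism `E ⊗[K] L → ∏_{φ : E →ₐ[K] L} L`, `e ⊗ c ↦ (φ(e) · c)_φ`, is an
isomorphism of `L`-algebras. -/
theorem tensor_product_iso_pi_of_card_algHom
    (K E L : Type*) [Field K] [Field E] [Field L]
    [Algebra K E] [FiniteDimensional K E] [Algebra.IsSeparable K E]
    [Algebra K L]
    (hcard : Nat.card (E →ₐ[K] L) = Module.finrank K E)
    (Φ : E ⊗[K] L →ₐ[L] ((E →ₐ[K] L) → L))
    (hΦ : ∀ (e : E) (c : L), Φ (e ⊗ₜ[K] c) = fun φ : E →ₐ[K] L => φ e * c) :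
    Function.Bijective Φ := by
  have : Finite (E →ₐ[K] L) :=
    Nat.finite_of_card_ne_zero (hcard ▸ Module.finrank_pos.ne')
  have := Fintype.ofFinite (E →ₐ[K] L)
  let comm : L ⊗[K] E ≃ₗ[L] E ⊗[K] L := (Algebra.TensorProduct.commRight K L E).toLinearEquiv
  have : FiniteDimensional L (E ⊗[K] L) := Module.Finite.equiv comm
  have hrank : Module.finrank L (E ⊗[K] L) = Module.finrank L ((E →ₐ[K] L) → L) := by
    rw [← comm.finrank_eq, Module.finrank_baseChange, Module.finrank_fintype_fun_eq_card,
      ← Nat.card_eq_fintype_card, hcard]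
  have hsurj : Function.Surjective Φ.toLinearMap := by
    rw [← LinearMap.range_eq_top, eq_top_iff, ← span_range_algHom_apply_eq_top K E L,
      Submodule.span_le]
    rintro _ ⟨e, rfl⟩
    exact ⟨e ⊗ₜ 1, by simp [hΦ]⟩
  exact ⟨(LinearMap.injective_iff_surjective_of_finrank_eq_finrank hrank).mpr hsurj, hsurj⟩
end
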